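/- For every n ∈ ℕ and every finite family A_1, …, A_m of n × n complex matrices, one has ‖Σ_{i=1}^m A_i* A_i‖ ≤ n² · ‖Σ_{i=1}^m A_i A_i*‖, where ‖·‖ is the operator norm on n × n matrices (the norm as operators on ℂⁿ with the Euclidean inner product) and A* denotes the conjugate transpose of A. -/

import Mathlib

open Matrix
open scoped BigOperators

open scoped Matrix.Norms.L2Operator in
theorem Matrix.norm_entry_le_l2_opNorm {m n : Type*} [Fintype m] [Fintype n] [DecidableEq n]
    {𝕜 : Type*} [RCLike 𝕜] (A : Matrix m n 𝕜) (i : m) (j : n) : ‖A i j‖ ≤ ‖A‖ := by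
  have h := A.l2_opNorm_mulVec (EuclideanSpace.single j (1 : 𝕜))
  rw [PiLp.norm_single, norm_one, mul_one] at h
  refine le_trans ?_ h
  simpa using PiLp.norm_apply_le (WithLp.toLp 2 (A *ᵥ (EuclideanSpace.single j (1 : 𝕜)).ofLp)) i

open scoped Matrix.Norms.L2Operator in
theorem Matrix.l2_opNorm_sq_le_sum_norm_sq {m n : Type*} [Fintype m] [Fintype n] [DecidableEq n]
    {𝕜 : Type*} [RCLike 𝕜] (A : Matrix m n 𝕜) : ‖A‖ ^ 2 ≤ ∑ i, ∑ j, ‖A i j‖ ^ 2 := by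
  have hS : 0 ≤ ∑ i, ∑ j, ‖A i j‖ ^ 2 := by positivity
  rw [← Real.le_sqrt (norm_nonneg _) hS, l2_opNorm_def]
  refine ContinuousLinearMap.opNorm_le_bound _ (Real.sqrt_nonneg _) fun x => ?_
  refine le_of_sq_le_sq ?_ (by positivity)
  rw [mul_pow, Real.sq_sqrt hS, EuclideanSpace.norm_sq_eq, EuclideanSpace.norm_sq_eq,
    Finset.sum_mul]
  refine Finset.sum_le_sum fun i _ => ?_
  calc ‖∑ j, A i j * x j‖ ^ 2 ≤ (∑ j, ‖A i j‖ * ‖x j‖) ^ 2 := by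
        gcongr
        simpa only [norm_mul] using norm_sum_le Finset.univ fun j => A i j * x j
    _ ≤ _ := Finset.sum_mul_sq_le_sq_mul_sq _ _ _

/-- For every `n` and every finite family `A 1, …, A m` of `n × n` complex matrices,
`‖∑ i, (A i)* (A i)‖ ≤ n² ‖∑ i, (A i) (A i)*‖` in the operator norm on `ℂⁿ`. -/
theorem sum_star_mul_le_sq_mul_sum_mul_star
    (n m : ℕ) (A : Fin m → Matrix (Fin n) (Fin n) ℂ) :
    ‖Matrix.toEuclideanCLM (𝕜 := ℂ) (∑ i, (A i)ᴴ * A i)‖ ≤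
      (n : ℝ) ^ 2 * ‖Matrix.toEuclideanCLM (𝕜 := ℂ) (∑ i, A i * (A i)ᴴ)‖ := by
  open scoped Matrix.Norms.L2Operator in
  rw [← cstar_norm_def, ← cstar_norm_def]
  have diag (j : Fin n) : ∑ i, ∑ k, ‖A i j k‖ ^ 2 ≤ ‖∑ i, A i * (A i)ᴴ‖ := by
    refine le_trans (le_of_eq ?_) (norm_entry_le_l2_opNorm _ j j)
    have h : (∑ i, A i * (A i)ᴴ) j j = ((∑ i, ∑ k, ‖A i j k‖ ^ 2 : ℝ) : ℂ) := by
      simp [Matrix.sum_apply, Matrix.mul_apply, Complex.mul_conj']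
    rw [h, Complex.norm_real, Real.norm_of_nonneg (by positivity)]
  calc ‖∑ i, (A i)ᴴ * A i‖ ≤ ∑ i, ‖A i‖ ^ 2 := by
        refine (norm_sum_le _ _).trans_eq ?_
        simp only [l2_opNorm_conjTranspose_mul_self, sq]
    _ ≤ ∑ i, ∑ j, ∑ k, ‖A i j k‖ ^ 2 :=
        Finset.sum_le_sum fun i _ => l2_opNorm_sq_le_sum_norm_sq (A i)
    _ = ∑ j, ∑ i, ∑ k, ‖A i j k‖ ^ 2 := Finset.sum_comm
    _ ≤ ∑ _j : Fin n, ‖∑ i, A i * (A i)ᴴ‖ := Finset.sum_le_sum fun j _ => diag j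
    _ = n * ‖∑ i, A i * (A i)ᴴ‖ := by simp
    _ ≤ n ^ 2 * ‖∑ i, A i * (A i)ᴴ‖ := by
        gcongr
        exact_mod_cast Nat.le_self_pow two_ne_zero n
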